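/- Let N ≥ 2, let λ : {1,…,N} → ℝ be nondecreasing, set λ_avg = (1/N) Σ_{n=1}^N λ_n, and suppose J ∈ {1,…,N−1} satisfies λ_J ≤ λ_avg < λ_{J+1}. Let h : {1,…,N} → ℝ with min_{1 ≤ n ≤ J} |h_n| > 0 and max_{J+1 ≤ n ≤ N} |h_n| < min_{1 ≤ n ≤ J} |h_n| (i.e. η_J < 1). Then Σ_{n=1}^N (λ_n − λ_avg) h_n² < 0, i.e. N · Σ_{n=1}^N λ_n h_n² < (Σ_{n=1}^N λ_n)(Σ_{n=1}^N h_n²). -/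

import Mathlib

/-- If the deviations `a n` sum to zero and `w n` lies on the side of the threshold `c` opposite
to the sign of `a n`, strictly so at some `k` with `a k ≠ 0`, then the weighted sum is negative. -/
theorem sum_mul_neg_of_sum_eq_zero {ι : Type*} {s : Finset ι} {a w : ι → ℝ} (c : ℝ)
    (ha : ∑ n ∈ s, a n = 0) (hle : ∀ n ∈ s, a n * (w n - c) ≤ 0)
    (hlt : ∃ n ∈ s, a n * (w n - c) < 0) : ∑ n ∈ s, a n * w n < 0 := by
  have hneg : ∑ n ∈ s, a n * (w n - c) < 0 := by
    simpa using Finset.sum_lt_sum (g := fun _ => (0 : ℝ)) hle hlt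
  simpa [mul_sub, ← Finset.sum_mul, ha] using hneg

/-- Special case `K = J` of Claim 1: any graph low-pass filter of order `J`
(i.e. `η_J < 1`), where `J` is the index with `λ_J ≤ λ_avg < λ_{J+1}`, is a
smooth graph filter. -/
theorem smooth_of_lpf_order_J
    (N J : ℕ) (hN : 2 ≤ N) (lam h : ℕ → ℝ)
    (hlam_mono : ∀ i j, 1 ≤ i → i ≤ j → j ≤ N → lam i ≤ lam j)
    (lamavg : ℝ) (hlamavg : lamavg = (∑ n ∈ Finset.Icc 1 N, lam n) / N)
    (hJ1 : 1 ≤ J) (hJN : J ≤ N - 1)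
    (hJle : lam J ≤ lamavg) (hJlt : lamavg < lam (J + 1))
    (hmin_pos :
      0 < (Finset.Icc 1 J).inf' (Finset.nonempty_Icc.mpr hJ1) (fun n => |h n|))
    (hmaxmin :
      (Finset.Icc (J + 1) N).sup'
          (Finset.nonempty_Icc.mpr (by omega)) (fun n => |h n|) <
        (Finset.Icc 1 J).inf' (Finset.nonempty_Icc.mpr hJ1) (fun n => |h n|)) :
    ∑ n ∈ Finset.Icc 1 N, (lam n - lamavg) * (h n) ^ 2 < 0 ∧
      (N : ℝ) * ∑ n ∈ Finset.Icc 1 N, lam n * (h n) ^ 2 <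
        (∑ n ∈ Finset.Icc 1 N, lam n) * (∑ n ∈ Finset.Icc 1 N, (h n) ^ 2) := by
  have hNpos : (0 : ℝ) < N := by exact_mod_cast (by omega : 0 < N)
  have hsum : ∑ n ∈ Finset.Icc 1 N, lam n = N * lamavg := by
    rw [hlamavg]; field_simp
  set m := (Finset.Icc 1 J).inf' (Finset.nonempty_Icc.mpr hJ1) (fun n => |h n|)
  have hlow : ∀ n, 1 ≤ n → n ≤ J → m ^ 2 ≤ h n ^ 2 := fun n h1 h2 => by
    rw [← sq_abs (h n)]
    exact pow_le_pow_left₀ hmin_pos.le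
      (Finset.inf'_le (fun n => |h n|) (Finset.mem_Icc.mpr ⟨h1, h2⟩)) 2
  have hhigh : ∀ n, J + 1 ≤ n → n ≤ N → h n ^ 2 < m ^ 2 := fun n h1 h2 => by
    rw [← sq_abs (h n)]
    exact pow_lt_pow_left₀ ((Finset.le_sup' (fun n => |h n|)
      (Finset.mem_Icc.mpr ⟨h1, h2⟩)).trans_lt hmaxmin) (abs_nonneg _) two_ne_zero
  have hneg : ∑ n ∈ Finset.Icc 1 N, (lam n - lamavg) * (h n) ^ 2 < 0 := by
    refine sum_mul_neg_of_sum_eq_zero (m ^ 2) (by simp [hsum]) (fun n hn => ?_)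
      ⟨J + 1, Finset.mem_Icc.mpr (by omega), mul_neg_of_pos_of_neg (sub_pos.mpr hJlt)
        (sub_neg.mpr (hhigh _ le_rfl (by omega)))⟩
    obtain ⟨h1, h2⟩ := Finset.mem_Icc.mp hn
    rcases le_or_gt n J with hnJ | hnJ
    · exact mul_nonpos_of_nonpos_of_nonneg
        (sub_nonpos.mpr ((hlam_mono n J h1 hnJ (by omega)).trans hJle))
        (sub_nonneg.mpr (hlow n h1 hnJ))
    · exact mul_nonpos_of_nonneg_of_nonpos
        (sub_nonneg.mpr (hJlt.le.trans (hlam_mono (J + 1) n (by omega) hnJ h2)))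
        (sub_nonpos.mpr (hhigh n hnJ h2).le)
  refine ⟨hneg, ?_⟩
  rw [hsum, mul_assoc]
  refine mul_lt_mul_of_pos_left ?_ hNpos
  simpa [sub_mul, ← Finset.mul_sum] using hneg
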